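/- Let t ∈ ℂ, t ≠ 0, λ = −t², and let V : ℝ → ℂ be continuous. Let μ : ℝ → ℂ be continuous and assume that for every x ∈ ℝ the function y ↦ e^{−ty}V(y)μ(y) is integrable on [x,∞) and y ↦ e^{ty}V(y)μ(y) is integrable on (−∞,x]. If μ satisfies, for every x ∈ ℝ, μ(x) = −(1/(2t))∫_x^∞ e^{−t(y−x)}V(y)μ(y) dy − (1/(2t))∫_{−∞}^x e^{t(y−x)}V(y)μ(y) dy, then μ is twice continuously differentiable on ℝ and μ''(x) + (λ − V(x))μ(x) = 0 for all x ∈ ℝ. -/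

import Mathlib

open MeasureTheory Set Filter

theorem hasDerivAt_integral_Iic {f : ℝ → ℂ} (hf : Continuous f)
    (hint : ∀ x, IntegrableOn f (Iic x)) (x : ℝ) :
    HasDerivAt (fun u => ∫ y in Iic u, f y) (f x) x := by
  have h : (fun u => ∫ y in Iic u, f y) =
      fun u => (∫ y in Iic (0 : ℝ), f y) + ∫ y in (0 : ℝ)..u, f y := by
    funext u
    rw [← intervalIntegral.integral_Iic_sub_Iic (hint 0) (hint u)]
    ring
  rw [h]
  exact (hf.integral_hasStrictDerivAt 0 x).hasDerivAt.const_add _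

theorem hasDerivAt_integral_Ici {f : ℝ → ℂ} (hf : Continuous f)
    (hint : ∀ x, IntegrableOn f (Ici x)) (x : ℝ) :
    HasDerivAt (fun u => ∫ y in Ici u, f y) (-f x) x := by
  have h : (fun u => ∫ y in Ici u, f y) =
      fun u => (∫ y in Ici (0 : ℝ), f y) - ∫ y in (0 : ℝ)..u, f y := by
    funext u
    rw [integral_Ici_eq_integral_Ioi, integral_Ici_eq_integral_Ioi,
      ← intervalIntegral.integral_Ioi_sub_Ioi' ((hint 0).mono_set Ioi_subset_Ici_self)
        ((hint u).mono_set Ioi_subset_Ici_self)]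
    ring
  rw [h]
  exact (hf.integral_hasStrictDerivAt 0 x).hasDerivAt.const_sub _

theorem setIntegral_exp_mul_sub (s : Set ℝ) (a : ℂ) (V μ : ℝ → ℂ) (x : ℝ) :
    ∫ y in s, Complex.exp (a * ((y : ℂ) - (x : ℂ))) * V y * μ y =
      Complex.exp (-a * x) * ∫ y in s, Complex.exp (a * y) * V y * μ y := by
  rw [← integral_const_mul]
  congr 1
  funext y
  rw [show a * ((y : ℂ) - (x : ℂ)) = -a * x + a * y by ring, Complex.exp_add]
  ring

theorem hasDerivAt_exp_mul_ofReal (a : ℂ) (x : ℝ) :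
    HasDerivAt (fun u : ℝ => Complex.exp (a * u)) (Complex.exp (a * x) * a) x := by
  simpa using ((Complex.ofRealCLM.hasDerivAt (x := x)).const_mul a).cexp

/-- Let `t ≠ 0`, `λ = -t²`, `V : ℝ → ℂ` continuous, and `μ : ℝ → ℂ`
continuous satisfying the integrability conditions and the integral equation
`μ(x) = -(1/(2t)) ∫_x^∞ e^{-t(y-x)} V μ dy - (1/(2t)) ∫_{-∞}^x e^{t(y-x)} V μ dy`
for every `x`.  Then `μ` is twice continuously differentiable and
`μ'' + (λ - V)μ = 0` on `ℝ`. -/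
theorem statement5 (t : ℂ) (ht : t ≠ 0) (lam : ℂ) (hlam : lam = -t ^ 2)
    (V : ℝ → ℂ) (hV : Continuous V) (μ : ℝ → ℂ) (hμ : Continuous μ)
    (hintp : ∀ x : ℝ, IntegrableOn (fun y : ℝ => Complex.exp (-t * y) * V y * μ y) (Ici x))
    (hintm : ∀ x : ℝ, IntegrableOn (fun y : ℝ => Complex.exp (t * y) * V y * μ y) (Iic x))
    (heq : ∀ x : ℝ, μ x =
      -(1 / (2 * t)) * (∫ y in Ici x, Complex.exp (-t * ((y : ℂ) - (x : ℂ))) * V y * μ y)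
      - (1 / (2 * t)) * (∫ y in Iic x, Complex.exp (t * ((y : ℂ) - (x : ℂ))) * V y * μ y)) :
    ContDiff ℝ 2 μ ∧ ∀ x : ℝ, deriv (deriv μ) x + (lam - V x) * μ x = 0 := by
  have hA := hasDerivAt_integral_Ici (f := fun y : ℝ => Complex.exp (-t * y) * V y * μ y)
    (by fun_prop) hintp
  have hB := hasDerivAt_integral_Iic (f := fun y : ℝ => Complex.exp (t * y) * V y * μ y)
    (by fun_prop) hintm
  set A : ℝ → ℂ := fun u => ∫ y in Ici u, Complex.exp (-t * y) * V y * μ y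
  set B : ℝ → ℂ := fun u => ∫ y in Iic u, Complex.exp (t * y) * V y * μ y
  have hexp : ∀ x : ℝ, Complex.exp (t * x) * Complex.exp (-t * x) = 1 := fun x => by
    rw [← Complex.exp_add]
    simp
  have hP : ∀ x : ℝ, HasDerivAt (fun u : ℝ => Complex.exp (t * u) * A u)
      (t * (Complex.exp (t * x) * A x) - V x * μ x) x := fun x => by
    refine ((hasDerivAt_exp_mul_ofReal t x).mul (hA x)).congr_deriv ?_
    linear_combination -(V x * μ x) * hexp x
  have hM : ∀ x : ℝ, HasDerivAt (fun u : ℝ => Complex.exp (-t * u) * B u)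
      (-t * (Complex.exp (-t * x) * B x) + V x * μ x) x := fun x => by
    refine ((hasDerivAt_exp_mul_ofReal (-t) x).mul (hB x)).congr_deriv ?_
    linear_combination (V x * μ x) * hexp x
  have hμeq : ∀ x : ℝ, μ x = -(1 / (2 * t)) *
      (Complex.exp (t * x) * A x + Complex.exp (-t * x) * B x) := fun x => by
    refine (heq x).trans ?_
    rw [setIntegral_exp_mul_sub, setIntegral_exp_mul_sub, neg_neg]
    ring
  have h1 : ∀ x : ℝ, HasDerivAt μ
      (-(1 / 2) * (Complex.exp (t * x) * A x - Complex.exp (-t * x) * B x)) x := fun x => by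
    have h := ((hP x).add (hM x)).const_mul (-(1 / (2 * t)))
    rw [funext hμeq]
    refine h.congr_deriv ?_
    field_simp
    ring
  have hd1 := funext fun x : ℝ => (h1 x).deriv
  have h2 : ∀ x : ℝ, HasDerivAt (deriv μ) ((V x - lam) * μ x) x := fun x => by
    rw [hd1]
    refine (((hP x).sub (hM x)).const_mul (-(1 / 2))).congr_deriv ?_
    rw [hlam, hμeq x]
    field_simp
    ring
  have hd2 := funext fun x : ℝ => (h2 x).deriv
  refine ⟨?_, fun x => by rw [hd2]; ring⟩
  rw [show (2 : WithTop ℕ∞) = 1 + 1 by norm_num, contDiff_succ_iff_deriv]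
  refine ⟨fun x => (h1 x).differentiableAt, by simp, contDiff_one_iff_deriv.2
    ⟨fun x => (h2 x).differentiableAt, ?_⟩⟩
  rw [hd2]
  fun_prop
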